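/- For every ε > 0 there is a constant K > 0 such that for all r ≥ 1, the number of zeros of the Riemann zeta function ζ (counted with multiplicity) lying in the closed disc |s| ≤ r and in the critical strip 0 ≤ Re(s) ≤ 1 is at most K·r^{1+ε}. -/

import Mathlib

open Complex Filter Topology

/-- `f` has a zero of exact order `m` at `z`. -/
def ZeroOfOrder (f : ℂ → ℂ) (z : ℂ) (m : ℕ) : Prop :=
  ∃ g : ℂ → ℂ, AnalyticAt ℂ g z ∧ g z ≠ 0 ∧
    ∀ᶠ w in 𝓝[≠] z, f w = (w - z) ^ m * g w

/-- If an entire function is locally divisible by `(w - z) ^ m`, it is so globally, with entire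
quotient. -/
theorem exists_entire_eq_sub_pow_mul {f : ℂ → ℂ} (hf : Differentiable ℂ f) {z : ℂ} {m : ℕ}
    {g : ℂ → ℂ} (hg : AnalyticAt ℂ g z) (h : ∀ᶠ w in 𝓝 z, f w = (w - z) ^ m * g w) :
    ∃ k : ℂ → ℂ, Differentiable ℂ k ∧ ∀ w, f w = (w - z) ^ m * k w := by
  classical
  refine ⟨fun w ↦ if w = z then g z else f w / (w - z) ^ m, fun w ↦ ?_, fun w ↦ ?_⟩
  · rcases eq_or_ne w z with rfl | hw
    · refine hg.differentiableAt.congr_of_eventuallyEq ?_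
      filter_upwards [h] with u hu
      split_ifs with huw
      · rw [huw]
      · rw [hu, mul_div_cancel_left₀ _ (pow_ne_zero _ (sub_ne_zero.2 huw))]
    · have : DifferentiableAt ℂ (fun u ↦ f u / (u - z) ^ m) w :=
        (hf w).div (by fun_prop) (pow_ne_zero _ (sub_ne_zero.2 hw))
      refine this.congr_of_eventuallyEq ?_
      filter_upwards [isOpen_ne.mem_nhds hw] with u hu
      exact if_neg hu
  · dsimp only
    split_ifs with hw
    · rw [hw]
      exact h.self_of_nhds
    · rw [mul_div_cancel₀ _ (pow_ne_zero _ (sub_ne_zero.2 hw))]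

/-- An entire function can be divided by finitely many of its zeros, with multiplicity. -/
theorem exists_entire_eq_prod_sub_pow_mul (m : ℂ → ℕ) (S : Finset ℂ) {f : ℂ → ℂ}
    (hf : Differentiable ℂ f)
    (h : ∀ z ∈ S, ∃ g : ℂ → ℂ, AnalyticAt ℂ g z ∧ ∀ᶠ w in 𝓝 z, f w = (w - z) ^ m z * g w) :
    ∃ k : ℂ → ℂ, Differentiable ℂ k ∧ ∀ w, f w = (∏ z ∈ S, (w - z) ^ m z) * k w := by
  classical
  induction S using Finset.induction generalizing f with
  | empty => exact ⟨f, hf, fun w ↦ by simp⟩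
  | insert a S ha ih =>
    obtain ⟨g, hg, hfg⟩ := h a (Finset.mem_insert_self a S)
    obtain ⟨k, hk, hfk⟩ := exists_entire_eq_sub_pow_mul hf hg hfg
    have hkS : ∀ z ∈ S, ∃ g : ℂ → ℂ, AnalyticAt ℂ g z ∧
        ∀ᶠ w in 𝓝 z, k w = (w - z) ^ m z * g w := by
      intro z hz
      have hza : z ≠ a := fun h ↦ ha (h ▸ hz)
      obtain ⟨g, hg, hfg⟩ := h z (Finset.mem_insert_of_mem hz)
      refine ⟨fun w ↦ g w / (w - a) ^ m a,
        hg.div (by fun_prop) (pow_ne_zero _ (sub_ne_zero.2 hza)), ?_⟩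
      filter_upwards [hfg, isOpen_ne.mem_nhds hza] with w hw hwa
      have hne : (w - a) ^ m a ≠ 0 := pow_ne_zero _ (sub_ne_zero.2 hwa)
      rw [← mul_div_assoc, ← hw, hfk w, mul_div_cancel_left₀ _ hne]
    obtain ⟨l, hl, hkl⟩ := ih hk hkS
    exact ⟨l, hl, fun w ↦ by rw [Finset.prod_insert ha, hfk w, hkl w, mul_assoc]⟩

/-- A bound of Jensen type: the number `N` of zeros of an entire function `f` in the disc of
radius `r` satisfies `‖f 0‖ * 2 ^ N ≤ sup_{|z| = 3r} ‖f z‖`. -/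
theorem norm_mul_two_pow_le_of_zeros {f : ℂ → ℂ} (hf : Differentiable ℂ f) {r M : ℝ} (hr : 0 < r)
    (hM : ∀ z, ‖z‖ = 3 * r → ‖f z‖ ≤ M) {m : ℂ → ℕ} {S : Finset ℂ} (hS : ∀ z ∈ S, ‖z‖ ≤ r)
    (h : ∀ z ∈ S, ∃ g : ℂ → ℂ, AnalyticAt ℂ g z ∧ ∀ᶠ w in 𝓝 z, f w = (w - z) ^ m z * g w) :
    ‖f 0‖ * 2 ^ (∑ z ∈ S, m z) ≤ M := by
  obtain ⟨k, hk, hfk⟩ := exists_entire_eq_prod_sub_pow_mul m S hf h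
  set N := ∑ z ∈ S, m z with hN
  have hprod0 : ‖∏ z ∈ S, (0 - z) ^ m z‖ ≤ r ^ N := by
    rw [norm_prod, hN, ← Finset.prod_pow_eq_pow_sum]
    refine Finset.prod_le_prod (fun _ _ ↦ norm_nonneg _) fun z hz ↦ ?_
    rw [norm_pow, zero_sub, norm_neg]
    gcongr
    exact hS z hz
  have hprod : ∀ w : ℂ, ‖w‖ = 3 * r → (2 * r) ^ N ≤ ‖∏ z ∈ S, (w - z) ^ m z‖ := by
    intro w hw
    rw [norm_prod, hN, ← Finset.prod_pow_eq_pow_sum]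
    refine Finset.prod_le_prod (fun _ _ ↦ by positivity) fun z hz ↦ ?_
    rw [norm_pow]
    gcongr
    have := norm_sub_norm_le w z
    linarith [hS z hz]
  have hpos : (0 : ℝ) < (2 * r) ^ N := by positivity
  have hk0 : ‖k 0‖ ≤ M / (2 * r) ^ N := by
    refine norm_le_of_forall_mem_frontier_norm_le (U := Metric.ball 0 (3 * r))
      Metric.isBounded_ball hk.diffContOnCl (fun w hw ↦ ?_)
      (subset_closure (Metric.mem_ball_self (by positivity)))
    rw [frontier_ball _ (by positivity), mem_sphere_zero_iff_norm] at hw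
    rw [le_div_iff₀' hpos]
    calc (2 * r) ^ N * ‖k w‖ ≤ ‖∏ z ∈ S, (w - z) ^ m z‖ * ‖k w‖ := by
          gcongr
          exact hprod w hw
      _ = ‖f w‖ := by rw [hfk w, norm_mul]
      _ ≤ M := hM w hw
  calc ‖f 0‖ * 2 ^ N ≤ (r ^ N * ‖k 0‖) * 2 ^ N := by
        rw [hfk 0, norm_mul]
        gcongr
    _ = (2 * r) ^ N * ‖k 0‖ := by rw [mul_pow]; ring
    _ ≤ M := by rwa [le_div_iff₀' hpos] at hk0

/-- A Mellin transform is bounded on closed vertical strips inside its domain of convergence. -/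
theorem norm_mellin_le_of_mem_strip {f : ℝ → ℂ} {a b : ℝ} (ha : MellinConvergent f a)
    (hb : MellinConvergent f b) :
    ∃ C, ∀ s : ℂ, a ≤ s.re → s.re ≤ b → ‖mellin f s‖ ≤ C := by
  refine ⟨∫ t in Set.Ioi (0 : ℝ),
    (‖(t : ℂ) ^ ((a : ℂ) - 1) • f t‖ + ‖(t : ℂ) ^ ((b : ℂ) - 1) • f t‖), fun s has hsb ↦ ?_⟩
  refine MeasureTheory.norm_integral_le_of_norm_le (ha.norm.add hb.norm) ?_
  refine (MeasureTheory.ae_restrict_iff' measurableSet_Ioi).2 (Eventually.of_forall fun t ht ↦ ?_)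
  have ht0 : 0 < t := ht
  simp only [norm_smul, norm_cpow_eq_rpow_re_of_pos ht0, sub_re, one_re, ofReal_re]
  rw [← add_mul]
  gcongr
  rcases le_total 1 t with h1 | h1
  · have := Real.rpow_le_rpow_of_exponent_le h1 (sub_le_sub_right hsb 1)
    have := Real.rpow_nonneg ht0.le (a - 1)
    linarith
  · have := Real.rpow_le_rpow_of_exponent_ge ht0 h1 (sub_le_sub_right has 1)
    have := Real.rpow_nonneg ht0.le (b - 1)
    linarith

theorem norm_completedRiemannZeta₀_le_of_mem_strip (a b : ℝ) :
    ∃ C, ∀ s : ℂ, a ≤ s.re → s.re ≤ b → ‖completedRiemannZeta₀ s‖ ≤ C := by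
  let P := (HurwitzZeta.hurwitzEvenFEPair 0)
  have hconv (s : ℂ) : MellinConvergent P.f_modif s := by
    have hP := P.isStrongFEPair_toStrongFEPair
    obtain ⟨_, ht⟩ := exists_gt s.re
    obtain ⟨_, hu⟩ := exists_lt s.re
    exact mellinConvergent_of_isBigO_rpow P.toStrongFEPair.hf_int (hP.hf_top _) ht (hP.hf_zero _) hu
  obtain ⟨C, hC⟩ := norm_mellin_le_of_mem_strip (hconv (a / 2 : ℝ)) (hconv (b / 2 : ℝ))
  refine ⟨C / 2, fun s ha hb ↦ ?_⟩
  have hre : (s / 2).re = s.re / 2 := by simp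
  have := hC (s / 2) (by rw [hre]; linarith) (by rw [hre]; linarith)
  change ‖mellin P.f_modif (s / 2) / 2‖ ≤ C / 2
  rw [norm_div, Complex.norm_ofNat]
  linarith

theorem Real.Gamma_le_add_one_rpow {x : ℝ} (hx : 2 ≤ x) : Real.Gamma x ≤ (x + 1) ^ (x + 1) := by
  have h1 : x ≤ ⌈x⌉₊ := Nat.le_ceil x
  have h2 : (⌈x⌉₊ : ℝ) ≤ x + 1 := (Nat.ceil_lt_add_one (by linarith)).le
  calc Real.Gamma x ≤ Real.Gamma (⌈x⌉₊ + 1) :=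
        Real.Gamma_strictMonoOn_Ici.monotoneOn (Set.mem_Ici.2 hx)
          (Set.mem_Ici.2 (by linarith)) (by linarith)
    _ = (⌈x⌉₊.factorial : ℝ) := Real.Gamma_nat_eq_factorial _
    _ ≤ (⌈x⌉₊ : ℝ) ^ ⌈x⌉₊ := by exact_mod_cast Nat.factorial_le_pow _
    _ ≤ (x + 1) ^ ⌈x⌉₊ := by gcongr
    _ = (x + 1) ^ (⌈x⌉₊ : ℝ) := (Real.rpow_natCast _ _).symm
    _ ≤ (x + 1) ^ (x + 1) := Real.rpow_le_rpow_of_exponent_le (by linarith) h2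

theorem norm_Gamma_le_Gamma_re {s : ℂ} (hs : 0 < s.re) : ‖Gamma s‖ ≤ Real.Gamma s.re := by
  rw [Gamma_eq_integral hs, Real.Gamma_eq_integral hs, GammaIntegral]
  refine MeasureTheory.norm_integral_le_of_norm_le (Real.GammaIntegral_convergent hs) ?_
  refine (MeasureTheory.ae_restrict_iff' measurableSet_Ioi).2 (Eventually.of_forall fun t ht ↦ ?_)
  rw [norm_mul, norm_cpow_eq_rpow_re_of_pos ht, norm_real, Real.norm_of_nonneg (Real.exp_pos _).le]
  simp

theorem norm_riemannZeta_le_of_two_le_re :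
    ∃ Z, ∀ s : ℂ, 2 ≤ s.re → ‖riemannZeta s‖ ≤ Z := by
  refine ⟨∑' n : ℕ, 1 / (n : ℝ) ^ 2, fun s hs ↦ ?_⟩
  rw [zeta_eq_tsum_one_div_nat_cpow (by linarith)]
  refine tsum_of_norm_bounded (Real.summable_one_div_nat_pow.2 one_lt_two).hasSum fun n ↦ ?_
  rcases n.eq_zero_or_pos with rfl | hn
  · rw [Nat.cast_zero, zero_cpow (by rintro rfl; norm_num at hs)]
    simp
  · rw [norm_div, norm_one, norm_natCast_cpow_of_pos hn, ← Real.rpow_natCast]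
    have : (1 : ℝ) ≤ n := by exact_mod_cast hn
    gcongr
    exact_mod_cast hs

/-- The entire function `s (1 - s) Λ(s)`, where `Λ` is the completed Riemann zeta function. -/
noncomputable def entireXi (s : ℂ) : ℂ := s * (1 - s) * completedRiemannZeta₀ s - 1

theorem differentiable_entireXi : Differentiable ℂ entireXi := by
  have := differentiable_completedZeta₀
  unfold entireXi
  fun_prop

theorem entireXi_one_sub (s : ℂ) : entireXi (1 - s) = entireXi s := by
  rw [entireXi, entireXi, completedRiemannZeta₀_one_sub]
  ring

theorem entireXi_eq {s : ℂ} (h0 : s ≠ 0) (h1 : s ≠ 1) (hG : Gammaℝ s ≠ 0) :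
    entireXi s = s * (1 - s) * Gammaℝ s * riemannZeta s := by
  have h1' : 1 - s ≠ 0 := sub_ne_zero.2 h1.symm
  rw [riemannZeta_def_of_ne_zero h0, completedRiemannZeta_eq, entireXi]
  field_simp
  ring

/-- Zeros of `ζ` in the closed right half-plane are zeros of `entireXi` of at least the same
order. -/
theorem entireXi_eventually_eq_of_zeroOfOrder {z : ℂ} {m : ℕ} (hre : 0 ≤ z.re)
    (hz : riemannZeta z = 0) (h : ZeroOfOrder riemannZeta z m) :
    ∃ g : ℂ → ℂ, AnalyticAt ℂ g z ∧ ∀ᶠ w in 𝓝 z, entireXi w = (w - z) ^ m * g w := by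
  have h0 : z ≠ 0 := by
    rintro rfl
    norm_num [riemannZeta_zero] at hz
  have h1 : z ≠ 1 := by
    rintro rfl
    exact riemannZeta_one_ne_zero hz
  have hG : Gammaℝ z ≠ 0 := by
    rw [Ne, Gammaℝ_eq_zero_iff]
    rintro ⟨n, rfl⟩
    have hn : (n : ℝ) ≤ 0 := by
      have : -(2 * (n : ℝ)) ≥ 0 := by simpa using! hre
      linarith
    have : n = 0 := by exact_mod_cast le_antisymm hn n.cast_nonneg
    simp [this] at h0
  have hGan : AnalyticAt ℂ Gammaℝ z := by
    have := (differentiable_Gammaℝ_inv.analyticAt z).inv (inv_ne_zero hG)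
    exact this.congr (Eventually.of_forall fun w ↦ inv_inv _)
  obtain ⟨g, hg, -, hgz⟩ := h
  have hL : AnalyticAt ℂ (fun w ↦ w * (1 - w) * Gammaℝ w * g w) z := by fun_prop
  refine ⟨_, hL, ?_⟩
  have hR : AnalyticAt ℂ (fun w ↦ (w - z) ^ m * (w * (1 - w) * Gammaℝ w * g w)) z := by fun_prop
  refine ((differentiable_entireXi.analyticAt z).frequently_eq_iff_eventually_eq hR).1
    (Eventually.frequently ?_)
  have hne := (eventually_ne_nhds h0).and
    ((eventually_ne_nhds h1).and (hGan.continuousAt.eventually_ne hG))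
  filter_upwards [hgz, hne.filter_mono nhdsWithin_le_nhds] with w hw ⟨hw0, hw1, hwG⟩
  rw [entireXi_eq hw0 hw1 hwG, hw]
  ring

/-- `entireXi` has order of growth at most one, up to logarithms. -/
theorem norm_entireXi_le :
    ∃ D : ℝ, 0 < D ∧ ∀ s : ℂ, ‖entireXi s‖ ≤ D * (2 + ‖s‖) ^ (‖s‖ + 4) := by
  obtain ⟨C, hC⟩ := norm_completedRiemannZeta₀_le_of_mem_strip (-3) 4
  obtain ⟨Z, hZ⟩ := norm_riemannZeta_le_of_two_le_re
  have hC0 : 0 ≤ C := (norm_nonneg _).trans (hC 0 (by simp) (by simp))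
  have hZ0 : 0 ≤ Z := (norm_nonneg _).trans (hZ 2 (by simp))
  have hquad (s : ℂ) : ‖s * (1 - s)‖ ≤ (1 + ‖s‖) ^ 2 := by
    rw [norm_mul]
    have : ‖1 - s‖ ≤ 1 + ‖s‖ := (norm_sub_le _ _).trans (by simp)
    nlinarith [norm_nonneg s]
  have hright (s : ℂ) (hs : 4 ≤ s.re) : ‖entireXi s‖ ≤ Z * (1 + ‖s‖) ^ (‖s‖ + 3) := by
    have hsn : s.re ≤ ‖s‖ := re_le_norm s
    have h0 : s ≠ 0 := by rintro rfl; norm_num at hs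
    have h1 : s ≠ 1 := by rintro rfl; norm_num at hs
    have hre : (s / 2).re = s.re / 2 := by simp
    have hGamma : ‖Gammaℝ s‖ ≤ (1 + ‖s‖) ^ (‖s‖ + 1) := by
      rw [Gammaℝ_def, norm_mul, norm_cpow_eq_rpow_re_of_pos Real.pi_pos]
      have hpi : Real.pi ^ (-s / 2).re ≤ 1 := by
        refine Real.rpow_le_one_of_one_le_of_nonpos (by linarith [Real.pi_gt_three]) ?_
        rw [neg_div, neg_re, hre]
        linarith
      have hG : ‖Gamma (s / 2)‖ ≤ (1 + ‖s‖) ^ (‖s‖ + 1) := by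
        refine (norm_Gamma_le_Gamma_re (by rw [hre]; linarith)).trans ?_
        refine (Real.Gamma_le_add_one_rpow (by rw [hre]; linarith)).trans ?_
        rw [hre]
        calc (s.re / 2 + 1) ^ (s.re / 2 + 1) ≤ (1 + ‖s‖) ^ (s.re / 2 + 1) :=
              Real.rpow_le_rpow (by linarith) (by linarith) (by linarith)
          _ ≤ (1 + ‖s‖) ^ (‖s‖ + 1) :=
              Real.rpow_le_rpow_of_exponent_le (by linarith) (by linarith)
      calc _ ≤ 1 * (1 + ‖s‖) ^ (‖s‖ + 1) := by gcongr
        _ = _ := one_mul _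
    rw [entireXi_eq h0 h1 (Gammaℝ_ne_zero_of_re_pos (by linarith)), norm_mul, norm_mul]
    calc _ ≤ (1 + ‖s‖) ^ 2 * (1 + ‖s‖) ^ (‖s‖ + 1) * Z := by
          gcongr
          · exact hquad s
          · exact hZ s (by linarith)
      _ = Z * (1 + ‖s‖) ^ (‖s‖ + 3) := by
          rw [← Real.rpow_natCast, ← Real.rpow_add (by linarith), mul_comm]
          congr 2
          push_cast
          ring
  refine ⟨C + Z + 1, by positivity, fun s ↦ ?_⟩
  have hn := norm_nonneg s
  rcases le_total 4 s.re with h4 | h4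
  · calc ‖entireXi s‖ ≤ Z * (1 + ‖s‖) ^ (‖s‖ + 3) := hright s h4
      _ ≤ Z * (2 + ‖s‖) ^ (‖s‖ + 3) := by gcongr; norm_num
      _ ≤ Z * (2 + ‖s‖) ^ (‖s‖ + 4) := by
          gcongr
          · linarith
          · norm_num
      _ ≤ (C + Z + 1) * (2 + ‖s‖) ^ (‖s‖ + 4) := by gcongr; linarith
  rcases le_total s.re (-3) with h3 | h3
  · have hs1 : ‖1 - s‖ ≤ 1 + ‖s‖ := (norm_sub_le _ _).trans (by simp)
    have hn1 := norm_nonneg (1 - s)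
    have hre : 4 ≤ (1 - s).re := by
      rw [sub_re, one_re]
      linarith
    calc ‖entireXi s‖ = ‖entireXi (1 - s)‖ := by rw [entireXi_one_sub]
      _ ≤ Z * (1 + ‖1 - s‖) ^ (‖1 - s‖ + 3) := hright _ hre
      _ ≤ Z * (2 + ‖s‖) ^ (‖1 - s‖ + 3) := by
          refine mul_le_mul_of_nonneg_left ?_ hZ0
          exact Real.rpow_le_rpow (by linarith) (by linarith) (by linarith)
      _ ≤ Z * (2 + ‖s‖) ^ (‖s‖ + 4) := by
          refine mul_le_mul_of_nonneg_left ?_ hZ0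
          exact Real.rpow_le_rpow_of_exponent_le (by linarith) (by linarith)
      _ ≤ (C + Z + 1) * (2 + ‖s‖) ^ (‖s‖ + 4) := by gcongr; linarith
  · have hpow : (1 + ‖s‖) ^ 2 ≤ (2 + ‖s‖) ^ (‖s‖ + 4) := by
      calc (1 + ‖s‖) ^ 2 ≤ (2 + ‖s‖) ^ 2 := by gcongr; norm_num
        _ = (2 + ‖s‖) ^ (2 : ℝ) := (Real.rpow_natCast _ 2).symm
        _ ≤ (2 + ‖s‖) ^ (‖s‖ + 4) :=
            Real.rpow_le_rpow_of_exponent_le (by linarith) (by linarith)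
    have hone : 1 ≤ (2 + ‖s‖) ^ (‖s‖ + 4) := Real.one_le_rpow (by linarith) (by linarith)
    calc ‖entireXi s‖ ≤ ‖s * (1 - s)‖ * ‖completedRiemannZeta₀ s‖ + 1 := by
          rw [entireXi]
          refine (norm_sub_le _ _).trans ?_
          rw [norm_mul (s * (1 - s)), norm_one]
      _ ≤ (2 + ‖s‖) ^ (‖s‖ + 4) * C + (2 + ‖s‖) ^ (‖s‖ + 4) := by
          gcongr
          · exact (hquad s).trans hpow
          · exact hC s h3 h4
      _ ≤ (C + Z + 1) * (2 + ‖s‖) ^ (‖s‖ + 4) := by nlinarith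

/-- For every `ε > 0` there is `K > 0` such that for all `r ≥ 1`, the number of zeros of `ζ`
(counted with multiplicity) in the disc `|s| ≤ r` and the strip `0 ≤ Re s ≤ 1` is at most
`K r^{1+ε}`: every finite collection of such zeros, counted with their multiplicities,
has total count at most `K r^{1+ε}`. -/
theorem zeta_zero_counting (ε : ℝ) (hε : 0 < ε) :
    ∃ K : ℝ, 0 < K ∧ ∀ r : ℝ, 1 ≤ r →
      ∀ (S : Finset ℂ) (m : ℂ → ℕ),
        (∀ z ∈ S, ‖z‖ ≤ r ∧ 0 ≤ z.re ∧ z.re ≤ 1 ∧ riemannZeta z = 0 ∧ 1 ≤ m z ∧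
          ZeroOfOrder riemannZeta z (m z)) →
        ((∑ z ∈ S, m z : ℕ) : ℝ) ≤ K * r ^ (1 + ε) := by
  obtain ⟨D, hD, hbound⟩ := norm_entireXi_le
  have hlog2 : 0 < Real.log 2 := Real.log_pos one_lt_two
  refine ⟨(|Real.log D| + 7 * (5 ^ ε / ε)) / Real.log 2, by positivity, fun r hr S m hS ↦ ?_⟩
  have hr0 : 0 < r := by linarith
  set N := ∑ z ∈ S, m z
  have hN : (2 : ℝ) ^ N ≤ D * (2 + 3 * r) ^ (3 * r + 4) := by
    have := norm_mul_two_pow_le_of_zeros differentiable_entireXi hr0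
      (fun z hz ↦ hz ▸ hbound z) (fun z hz ↦ (hS z hz).1)
      (fun z hz ↦ entireXi_eventually_eq_of_zeroOfOrder (hS z hz).2.1 (hS z hz).2.2.2.1
        (hS z hz).2.2.2.2.2)
    simpa [entireXi] using this
  have hlog : N * Real.log 2 ≤ Real.log D + (3 * r + 4) * Real.log (2 + 3 * r) := by
    have := Real.log_le_log (by positivity) hN
    rwa [Real.log_pow, Real.log_mul hD.ne' (by positivity), Real.log_rpow (by positivity)] at this
  have hlog5 : Real.log (2 + 3 * r) ≤ 5 ^ ε / ε * r ^ ε := by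
    calc Real.log (2 + 3 * r) ≤ Real.log (5 * r) := Real.log_le_log (by positivity) (by linarith)
      _ ≤ (5 * r) ^ ε / ε := Real.log_le_rpow_div (by positivity) hε
      _ = 5 ^ ε / ε * r ^ ε := by rw [Real.mul_rpow (by norm_num) hr0.le]; ring
  have hone : 1 ≤ r ^ (1 + ε) := Real.one_le_rpow hr (by positivity)
  rw [div_mul_eq_mul_div, le_div_iff₀ hlog2]
  calc N * Real.log 2 ≤ Real.log D + (3 * r + 4) * Real.log (2 + 3 * r) := hlog
    _ ≤ |Real.log D| * r ^ (1 + ε) + (7 * r) * (5 ^ ε / ε * r ^ ε) := by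
        have hlog0 : 0 ≤ Real.log (2 + 3 * r) := Real.log_nonneg (by linarith)
        gcongr
        · exact (le_abs_self _).trans (le_mul_of_one_le_right (abs_nonneg _) hone)
        · linarith
    _ = (|Real.log D| + 7 * (5 ^ ε / ε)) * r ^ (1 + ε) := by
        rw [Real.rpow_add hr0, Real.rpow_one]
        ring
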